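/- There is a constant C > 0, independent of T, ψ, v and w, with the following property. Let ψ : [0,T]×ℝ³ → ℝ, v : [0,T]×ℝ³ → ℝ³ and w : [0,T]×ℝ³ → ℝ be smooth, Schwartz in the space variable for each t, and suppose −Δw(t,·) = Σ_{i,j=1}^3 ∂_i v_j ∂_j v_i on ℝ³ for each t ∈ [0,T]. Then |∫₀^T (∂₃w | Δψ)_{H¹} dt| ≤ C ‖∇v‖²_{L²_T(H²)} ‖∇ψ‖_{L^∞_T(H²)}. -/

import Mathlib

open MeasureTheory Real Set Filter
open scoped ENNReal NNReal

noncomputable section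

/-- Spatial points of `ℝ³`. -/
abbrev Pt : Type := Fin 3 → ℝ

/-- Partial derivative in the `i`-th coordinate direction. -/
def pd (i : Fin 3) (f : Pt → ℝ) : Pt → ℝ := fun x => fderiv ℝ f x (Pi.single i 1)

/-- Iterated partial derivative `∂^α` for a multi-index `α`. -/
def pdM (α : Fin 3 → ℕ) (f : Pt → ℝ) : Pt → ℝ :=
  (pd 0)^[α 0] ((pd 1)^[α 1] ((pd 2)^[α 2] f))

/-- Multi-indices of total degree at most `k`. -/
def midx (k : ℕ) : Finset (Fin 3 → ℕ) :=
  (Fintype.piFinset fun _ => Finset.range (k + 1)).filter fun α => ∑ i, α i ≤ k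

/-- The `H^k` inner product `(f|g)_{H^k} = ∑_{|α| ≤ k} ∫ ∂^α f ∂^α g`. -/
def hInner (k : ℕ) (f g : Pt → ℝ) : ℝ := ∑ α ∈ midx k, ∫ x : Pt, pdM α f x * pdM α g x

/-- The squared `H^k` norm. -/
def hSq (k : ℕ) (f : Pt → ℝ) : ℝ := hInner k f f

/-- The squared `L²` norm. -/
def l2Sq (f : Pt → ℝ) : ℝ := ∫ x : Pt, (f x) ^ 2

/-- The Laplacian. -/
def lapl (f : Pt → ℝ) : Pt → ℝ := fun x => ∑ i, pd i (pd i f) x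

/-- Horizontal directions. -/
def hIdx : Finset (Fin 3) := {0, 1}

/-- `L^∞` norm in time over `[0,T]` of a (nonnegative) function of time. -/
def supT (T : ℝ) (g : ℝ → ℝ) : ℝ := sSup (g '' Icc 0 T)

/-- `L²` norm in time over `[0,T]`. -/
def l2T (T : ℝ) (g : ℝ → ℝ) : ℝ := Real.sqrt (∫ t in (0:ℝ)..T, (g t) ^ 2)

/-- `L⁴` norm in time over `[0,T]`. -/
def l4T (T : ℝ) (g : ℝ → ℝ) : ℝ := (∫ t in (0:ℝ)..T, (g t) ^ 4) ^ ((1:ℝ)/4)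

/-- A function is Schwartz: smooth with all derivatives rapidly decaying. -/
def IsSchwartz (f : Pt → ℝ) : Prop :=
  ContDiff ℝ (⊤ : ℕ∞) f ∧ ∀ k n : ℕ, ∃ C : ℝ, ∀ x, ‖x‖ ^ k * ‖iteratedFDeriv ℝ n f x‖ ≤ C

/-- Smoothness of `f` jointly in `(t,x)` on `s ×ˢ ℝ³`. -/
def SmoothOn2 (s : Set ℝ) (f : ℝ → Pt → ℝ) : Prop :=
  ContDiffOn ℝ (⊤ : ℕ∞) (fun q : ℝ × Pt => f q.1 q.2) (s ×ˢ (univ : Set Pt))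

/-- `‖∇f‖_{H^k}²`. -/
def gradHSq (k : ℕ) (f : Pt → ℝ) : ℝ := ∑ i, hSq k (pd i f)

/-- `‖∇_h∇f‖_{H^k}²`. -/
def gradHHSq (k : ℕ) (f : Pt → ℝ) : ℝ := ∑ i ∈ hIdx, ∑ j, hSq k (pd i (pd j f))

/-- `‖v‖_{H^k}²` for a vector field. -/
def vecHSq (k : ℕ) (v : Fin 3 → Pt → ℝ) : ℝ := ∑ j, hSq k (v j)

/-- `‖∇v‖_{H^k}²` for a vector field. -/
def gradVecHSq (k : ℕ) (v : Fin 3 → Pt → ℝ) : ℝ := ∑ j, gradHSq k (v j)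

/-- `B_T²`. -/
def BTsq (T : ℝ) (ψ : ℝ → Pt → ℝ) (v : Fin 3 → ℝ → Pt → ℝ) : ℝ :=
  (supT T fun t => Real.sqrt (vecHSq 2 fun j => v j t)) ^ 2
  + (supT T fun t => Real.sqrt (gradHSq 2 (ψ t))) ^ 2
  + (l2T T fun t => Real.sqrt (gradVecHSq 2 fun j => v j t)) ^ 2
  + (l2T T fun t => Real.sqrt (gradHHSq 1 (ψ t))) ^ 2

/-- `B_T`. -/
def BT (T : ℝ) (ψ : ℝ → Pt → ℝ) (v : Fin 3 → ℝ → Pt → ℝ) : ℝ := Real.sqrt (BTsq T ψ v)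

/-- The transport equation `∂_tψ + v·∇ψ + v₃ = 0` on `s × ℝ³`. -/
def TransportEq (s : Set ℝ) (ψ : ℝ → Pt → ℝ) (v : Fin 3 → ℝ → Pt → ℝ) : Prop :=
  ∀ t ∈ s, ∀ x, deriv (fun τ => ψ τ x) t + (∑ i, v i t x * pd i (ψ t) x) + v 2 t x = 0

/-- Divergence-free condition on `s × ℝ³`. -/
def DivFree (s : Set ℝ) (v : Fin 3 → ℝ → Pt → ℝ) : Prop :=
  ∀ t ∈ s, ∀ x, (∑ i, pd i (fun y => v i t y) x) = 0

/-- The momentum equations of system (S) on `s × ℝ³`. -/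
def MomentumEq (s : Set ℝ) (ψ : ℝ → Pt → ℝ) (v : Fin 3 → ℝ → Pt → ℝ)
    (p : ℝ → Pt → ℝ) : Prop :=
  ∀ j : Fin 3, ∀ t ∈ s, ∀ x,
    deriv (fun τ => v j τ x) t + (∑ i, v i t x * pd i (v j t) x) - lapl (v j t) x
      + pd j (p t) x + pd j (pd 2 (ψ t)) x + (if j = 2 then lapl (ψ t) x else 0)
    = - ∑ i, pd i (fun y => pd j (ψ t) y * pd i (ψ t) y) x

/-- The full system (S) on `s × ℝ³`. -/
def SolvesS (s : Set ℝ) (ψ : ℝ → Pt → ℝ) (v : Fin 3 → ℝ → Pt → ℝ)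
    (p : ℝ → Pt → ℝ) : Prop :=
  TransportEq s ψ v ∧ MomentumEq s ψ v p ∧ DivFree s v

/-- Finiteness of the four norms entering `B_T`. -/
def FiniteClass (T : ℝ) (ψ : ℝ → Pt → ℝ) (v : Fin 3 → ℝ → Pt → ℝ) : Prop :=
  BddAbove ((fun t => Real.sqrt (vecHSq 2 fun j => v j t)) '' Icc 0 T) ∧
  BddAbove ((fun t => Real.sqrt (gradHSq 2 (ψ t))) '' Icc 0 T) ∧
  IntervalIntegrable (fun t => gradVecHSq 2 fun j => v j t) volume 0 T ∧
  IntervalIntegrable (fun t => gradHHSq 1 (ψ t)) volume 0 T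

section SobolevEstimates

open scoped SchwartzMap LineDeriv

/-- The partial derivative of a Schwartz function, as a Schwartz function. -/
def schwartzPd (i : Fin 3) (f : 𝓢(Pt, ℝ)) : 𝓢(Pt, ℝ) := ∂_{(Pi.single i (1 : ℝ) : Pt)} f

/-- The Laplacian of a Schwartz function, as a Schwartz function. -/
def schwartzLapl (f : 𝓢(Pt, ℝ)) : 𝓢(Pt, ℝ) := ∑ i, schwartzPd i (schwartzPd i f)

/-- The pointwise product of two Schwartz functions. -/
def schwartzMul (f g : 𝓢(Pt, ℝ)) : 𝓢(Pt, ℝ) :=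
  SchwartzMap.pairing (ContinuousLinearMap.mul ℝ ℝ) f g

@[simp]
lemma schwartzMul_apply (f g : 𝓢(Pt, ℝ)) (x : Pt) : schwartzMul f g x = f x * g x := rfl

lemma IsSchwartz.exists_schwartzMap {f : Pt → ℝ} (hf : IsSchwartz f) :
    ∃ F : 𝓢(Pt, ℝ), ⇑F = f :=
  ⟨⟨f, hf.1, hf.2⟩, rfl⟩

lemma pd_coe (i : Fin 3) (f : 𝓢(Pt, ℝ)) : pd i f = schwartzPd i f := rfl

lemma lapl_coe (f : 𝓢(Pt, ℝ)) : lapl f = schwartzLapl f := by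
  funext x
  simp [lapl, schwartzLapl, pd_coe]

lemma schwartzPd_comm (i j : Fin 3) (f : 𝓢(Pt, ℝ)) :
    schwartzPd i (schwartzPd j f) = schwartzPd j (schwartzPd i f) := by
  ext x
  have hd : Differentiable ℝ (fderiv ℝ f) :=
    ((f.smooth 2).fderiv_right (m := 1) (by norm_num)).differentiable (by norm_num)
  have key (a b : Fin 3) : schwartzPd a (schwartzPd b f) x
      = fderiv ℝ (fderiv ℝ f) x (Pi.single a 1) (Pi.single b 1) := by
    change fderiv ℝ (fun y => fderiv ℝ f y (Pi.single b 1)) x (Pi.single a 1) = _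
    rw [fderiv_clm_apply (hd x) (by fun_prop)]
    simp
  rw [key, key]
  exact ((f.smooth 2).contDiffAt.isSymmSndFDerivAt (by simp)) _ _

lemma schwartzPd_lapl (i : Fin 3) (f : 𝓢(Pt, ℝ)) :
    schwartzPd i (schwartzLapl f) = schwartzLapl (schwartzPd i f) := by
  have hs : schwartzPd i (schwartzLapl f) = ∑ j, schwartzPd i (schwartzPd j (schwartzPd j f)) :=
    LineDeriv.lineDerivOp_sum _ _ _
  rw [hs, schwartzLapl]
  refine Finset.sum_congr rfl fun j _ => ?_
  rw [schwartzPd_comm i j, schwartzPd_comm i j]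

lemma integrable_mul_schwartz (f g : 𝓢(Pt, ℝ)) : Integrable fun x => f x * g x :=
  (schwartzMul f g).integrable

lemma integral_mul_schwartzPd (i : Fin 3) (f g : 𝓢(Pt, ℝ)) :
    ∫ x, f x * schwartzPd i g x = -∫ x, schwartzPd i f x * g x :=
  SchwartzMap.integral_mul_lineDerivOp_right_eq_neg_left f g _

lemma integral_mul_schwartzLapl (f g : 𝓢(Pt, ℝ)) :
    ∫ x, f x * schwartzLapl g x = ∫ x, schwartzLapl f x * g x := by
  simp only [schwartzLapl, _root_.sum_apply, Finset.mul_sum, Finset.sum_mul]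
  rw [integral_finsetSum _ fun i _ => integrable_mul_schwartz f _,
    integral_finsetSum _ fun i _ => integrable_mul_schwartz _ g]
  refine Finset.sum_congr rfl fun i _ => ?_
  rw [integral_mul_schwartzPd, integral_mul_schwartzPd, neg_neg]

lemma integral_schwartzPd_mul_schwartzLapl (i : Fin 3) (f g : 𝓢(Pt, ℝ)) :
    ∫ x, schwartzPd i f x * schwartzLapl g x = -∫ x, schwartzLapl f x * schwartzPd i g x := by
  rw [integral_mul_schwartzLapl, ← schwartzPd_lapl, integral_mul_schwartzPd, neg_neg]

lemma hInner_one (f g : Pt → ℝ) :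
    hInner 1 f g = (∫ x, f x * g x) + ∑ k, ∫ x, pd k f x * pd k g x := by
  have h : midx 1 = {![0, 0, 0], ![1, 0, 0], ![0, 1, 0], ![0, 0, 1]} := by decide
  rw [hInner, h, Finset.sum_insert (by decide), Finset.sum_insert (by decide),
    Finset.sum_insert (by decide), Finset.sum_singleton, Fin.sum_univ_three]
  simp [pdM]
  ring

lemma pdM_mul_self_integral_nonneg (α : Fin 3 → ℕ) (f : Pt → ℝ) :
    0 ≤ ∫ x, pdM α f x * pdM α f x :=
  integral_nonneg fun _ => mul_self_nonneg _

lemma hSq_nonneg (k : ℕ) (f : Pt → ℝ) : 0 ≤ hSq k f :=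
  Finset.sum_nonneg fun _ _ => pdM_mul_self_integral_nonneg _ _

lemma hSq_one_le_two (f : Pt → ℝ) : hSq 1 f ≤ hSq 2 f :=
  Finset.sum_le_sum_of_subset_of_nonneg (show midx 1 ⊆ midx 2 by decide)
    fun α _ _ => pdM_mul_self_integral_nonneg α f

lemma integral_sq_add_sum_pd_pd_le_hSq_two (f : Pt → ℝ) :
    (∫ x, f x * f x) + ∑ k, ∫ x, pd k (pd k f) x * pd k (pd k f) x ≤ hSq 2 f := by
  have h : ({![0, 0, 0], ![2, 0, 0], ![0, 2, 0], ![0, 0, 2]} : Finset (Fin 3 → ℕ)) ⊆ midx 2 := by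
    decide
  refine le_trans (le_of_eq ?_) (Finset.sum_le_sum_of_subset_of_nonneg h
    fun α _ _ => pdM_mul_self_integral_nonneg α f)
  rw [Finset.sum_insert (by decide), Finset.sum_insert (by decide),
    Finset.sum_insert (by decide), Finset.sum_singleton, Fin.sum_univ_three]
  simp [pdM]
  ring

/-- Cauchy–Schwarz for Schwartz functions. -/
lemma sq_integral_mul_le (f g : 𝓢(Pt, ℝ)) :
    (∫ x, f x * g x) ^ 2 ≤ (∫ x, f x * f x) * ∫ x, g x * g x := by
  have h : ∀ t : ℝ, 0 ≤ (∫ x, f x * f x) * (t * t) + (2 * ∫ x, f x * g x) * t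
      + ∫ x, g x * g x := fun t => by
    have e : ∫ x, (t * f x + g x) * (t * f x + g x) = (∫ x, f x * f x) * (t * t)
        + (2 * ∫ x, f x * g x) * t + ∫ x, g x * g x := by
      have h1 := (integrable_mul_schwartz f f).const_mul (t * t)
      have h2 := (integrable_mul_schwartz f g).const_mul (2 * t)
      have h3 := integrable_mul_schwartz g g
      calc _ = ∫ x, ((t * t) * (f x * f x) + (2 * t) * (f x * g x) + g x * g x) := by
            congr 1; ext x; ring
        _ = _ := by
            rw [integral_add (by exact h1.add h2) h3, integral_add h1 h2, integral_const_mul,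
              integral_const_mul]
            ring
    rw [← e]
    exact integral_nonneg fun _ => mul_self_nonneg _
  have := discrim_le_zero h
  rw [discrim] at this
  linarith

lemma exists_gagliardo_nirenberg_const : ∃ K : ℝ, 0 ≤ K ∧ ∀ u : Pt → ℝ, ContDiff ℝ 1 u →
    HasCompactSupport u → ∫ x, u x ^ 6 ≤ K * (∫ x, ‖fderiv ℝ u x‖ ^ 2) ^ 3 := by
  set S := SNormLESNormFDerivOfEqConst ℝ (volume : Measure Pt) 2
  refine ⟨(S : ℝ) ^ 6, by positivity, fun u hu h2u => ?_⟩
  have h := eLpNorm_le_eLpNorm_fderiv_of_eq (volume : Measure Pt) hu h2u (p := 2) (p' := 6)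
    (by norm_num) (by simp) (by norm_num)
  have hm : MemLp u 6 (volume : Measure Pt) := hu.continuous.memLp_of_hasCompactSupport h2u
  have hm' : MemLp (fderiv ℝ u) 2 (volume : Measure Pt) :=
    (hu.continuous_fderiv (by norm_num)).memLp_of_hasCompactSupport (h2u.fderiv ℝ)
  have e6 := hm.eLpNorm_eq_integral_rpow_norm (by norm_num) (by norm_num)
  have e2 := hm'.eLpNorm_eq_integral_rpow_norm (by norm_num) (by norm_num)
  simp only [ENNReal.toReal_ofNat, ENNReal.coe_ofNat] at e6 e2 h
  rw [e6, e2, ← ENNReal.ofReal_coe_nnreal, ← ENNReal.ofReal_mul (by positivity),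
    ENNReal.ofReal_le_ofReal_iff (by positivity)] at h
  have a6 : ∀ x, ‖u x‖ ^ (6 : ℝ) = u x ^ 6 := fun x => by
    rw [show (6 : ℝ) = ((6 : ℕ) : ℝ) by norm_num, Real.rpow_natCast, Real.norm_eq_abs,
      Even.pow_abs (by decide)]
  simp only [a6, Real.rpow_two] at h
  have hA : 0 ≤ ∫ x, u x ^ 6 := integral_nonneg fun x => by positivity
  have hB : 0 ≤ ∫ x, ‖fderiv ℝ u x‖ ^ 2 := integral_nonneg fun x => by positivity
  have h6 := pow_le_pow_left₀ (by positivity) h 6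
  rw [mul_pow, ← Real.rpow_natCast, ← Real.rpow_mul hA, ← Real.rpow_natCast (_ ^ (2 : ℝ)⁻¹),
    ← Real.rpow_mul hB] at h6
  norm_num at h6
  exact_mod_cast h6

lemma norm_fderiv_le_sum_abs (f : 𝓢(Pt, ℝ)) (x : Pt) :
    ‖fderiv ℝ f x‖ ≤ ∑ k, |schwartzPd k f x| := by
  refine ContinuousLinearMap.opNorm_le_bound _ (by positivity) fun y => ?_
  have hy : fderiv ℝ f x y = ∑ k, y k * schwartzPd k f x := by
    conv_lhs => rw [pi_eq_sum_univ' y]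
    rw [map_sum]
    refine Finset.sum_congr rfl fun k _ => ?_
    rw [map_smul, smul_eq_mul]
    rfl
  rw [hy, Finset.sum_mul]
  refine (Finset.abs_sum_le_sum_abs _ _).trans (Finset.sum_le_sum fun k _ => ?_)
  rw [abs_mul, mul_comm]
  exact mul_le_mul_of_nonneg_left (norm_le_pi_norm y k) (abs_nonneg _)

lemma hSq_one_coe (f : 𝓢(Pt, ℝ)) :
    hSq 1 f = (∫ x, f x * f x) + ∑ k, ∫ x, schwartzPd k f x * schwartzPd k f x :=
  hInner_one f f

/-- The embedding `H¹ ⊂ L⁶`. -/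
lemma exists_integral_pow_six_le : ∃ K : ℝ, 0 ≤ K ∧ ∀ f : 𝓢(Pt, ℝ),
    ∫ x, f x ^ 6 ≤ K * hSq 1 f ^ 3 := by
  obtain ⟨K, hK, hKu⟩ := exists_gagliardo_nirenberg_const
  let χ : ContDiffBump (0 : Pt) := ⟨1, 2, by norm_num, by norm_num⟩
  have hχ : ContDiff ℝ 1 χ := χ.contDiff
  obtain ⟨M, hM⟩ := (hχ.continuous_fderiv (by norm_num)).bounded_above_of_compact_support
    (χ.hasCompactSupport.fderiv ℝ)
  have hM0 : 0 ≤ M := (norm_nonneg _).trans (hM 0)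
  refine ⟨K * (4 * (M ^ 2 + 1)) ^ 3, by positivity, fun f => ?_⟩
  let r : ℕ → ℝ := fun n => 1 / ((n : ℝ) + 1)
  have hr0 : ∀ n, 0 < r n := fun n => by positivity
  have hr1 : ∀ n, r n ≤ 1 := fun n => by
    rw [div_le_one (by positivity)]
    linarith [n.cast_nonneg (α := ℝ)]
  let u : ℕ → Pt → ℝ := fun n x => χ (r n • x) * f x
  have hf1 : ContDiff ℝ 1 f := f.smooth 1
  have hu : ∀ n, ContDiff ℝ 1 (u n) := fun n =>
    (hχ.comp (contDiff_const_smul (r n))).mul hf1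
  have hus : ∀ n, HasCompactSupport (u n) := fun n =>
    (χ.hasCompactSupport.comp_smul (hr0 n).ne').mul_right
  have hdu : ∀ n x, ‖fderiv ℝ (u n) x‖ ^ 2 ≤
      4 * (M ^ 2 + 1) * (f x * f x + ∑ k, schwartzPd k f x * schwartzPd k f x) := fun n x => by
    have hc : HasFDerivAt (fun y : Pt => χ (r n • y))
        ((fderiv ℝ χ (r n • x)).comp (r n • ContinuousLinearMap.id ℝ Pt)) x :=
      ((hχ.differentiable (by norm_num)) _).hasFDerivAt.comp x
        ((hasFDerivAt_id x).const_smul (r n))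
    have hd : HasFDerivAt (u n) _ x :=
      hc.mul ((hf1.differentiable (by norm_num)) x).hasFDerivAt
    have hb : ‖fderiv ℝ (u n) x‖ ≤ M * |f x| + ∑ k, |schwartzPd k f x| := by
      rw [hd.fderiv]
      refine (norm_add_le _ _).trans ?_
      rw [norm_smul, norm_smul, add_comm]
      have h1 : ‖(fderiv ℝ χ (r n • x)).comp (r n • ContinuousLinearMap.id ℝ Pt)‖ ≤ M := by
        rw [ContinuousLinearMap.comp_smul, norm_smul, ContinuousLinearMap.comp_id,
          Real.norm_of_nonneg (hr0 n).le]
        calc _ ≤ 1 * M := mul_le_mul (hr1 n) (hM _) (norm_nonneg _) zero_le_one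
          _ = M := one_mul M
      have h2 : ‖χ (r n • x)‖ ≤ 1 := by
        rw [Real.norm_of_nonneg χ.nonneg]
        exact χ.le_one
      refine add_le_add ?_ ?_
      · rw [Real.norm_eq_abs, mul_comm]
        exact mul_le_mul_of_nonneg_right h1 (abs_nonneg _)
      · calc _ ≤ 1 * ‖fderiv ℝ f x‖ := mul_le_mul_of_nonneg_right h2 (norm_nonneg _)
          _ ≤ _ := by rw [one_mul]; exact norm_fderiv_le_sum_abs f x
    have hb2 := pow_le_pow_left₀ (norm_nonneg _) hb 2
    refine hb2.trans ?_
    rw [Fin.sum_univ_three, Fin.sum_univ_three, ← abs_mul_abs_self (f x),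
      ← abs_mul_abs_self (schwartzPd 0 f x), ← abs_mul_abs_self (schwartzPd 1 f x),
      ← abs_mul_abs_self (schwartzPd 2 f x)]
    generalize |f x| = a
    generalize |schwartzPd 0 f x| = b
    generalize |schwartzPd 1 f x| = c
    generalize |schwartzPd 2 f x| = d
    have h4 : (M * a + (b + c + d)) ^ 2 ≤ 4 * ((M * a) ^ 2 + b ^ 2 + c ^ 2 + d ^ 2) := by
      nlinarith [sq_nonneg (M * a - b), sq_nonneg (M * a - c), sq_nonneg (M * a - d),
        sq_nonneg (b - c), sq_nonneg (b - d), sq_nonneg (c - d)]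
    have h5 : 0 ≤ M ^ 2 * (b ^ 2 + c ^ 2 + d ^ 2) + a ^ 2 := by positivity
    linarith
  have hInteg : Integrable fun x => f x * f x + ∑ k, schwartzPd k f x * schwartzPd k f x :=
    (integrable_mul_schwartz f f).add
      (integrable_finsetSum _ fun k _ => integrable_mul_schwartz _ _)
  have hI : ∫ x, (f x * f x + ∑ k, schwartzPd k f x * schwartzPd k f x) = hSq 1 f := by
    rw [hSq_one_coe, integral_add (integrable_mul_schwartz f f)
      (integrable_finsetSum _ fun k _ => integrable_mul_schwartz _ _),
      integral_finsetSum _ fun k _ => integrable_mul_schwartz _ _]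
  have hbound : ∀ n, ∫ x, u n x ^ 6 ≤ K * (4 * (M ^ 2 + 1)) ^ 3 * hSq 1 f ^ 3 := fun n => by
    have h1 : ∫ x, ‖fderiv ℝ (u n) x‖ ^ 2 ≤ 4 * (M ^ 2 + 1) * hSq 1 f := by
      rw [← hI, ← integral_const_mul]
      exact integral_mono_of_nonneg (ae_of_all _ fun x => by positivity) (hInteg.const_mul _)
        (ae_of_all _ (hdu n))
    calc _ ≤ K * (∫ x, ‖fderiv ℝ (u n) x‖ ^ 2) ^ 3 := hKu _ (hu n) (hus n)
      _ ≤ K * (4 * (M ^ 2 + 1) * hSq 1 f) ^ 3 :=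
        mul_le_mul_of_nonneg_left
          (pow_le_pow_left₀ (integral_nonneg fun x => by positivity) h1 3) hK
      _ = _ := by ring
  have hlim : Tendsto (fun n => ∫ x, u n x ^ 6) atTop (nhds (∫ x, f x ^ 6)) := by
    have h6 : Integrable fun x => f x ^ 6 := by
      convert! (schwartzMul (schwartzMul f f) (schwartzMul (schwartzMul f f)
        (schwartzMul f f))).integrable (μ := volume) using 2 with x
      simp only [schwartzMul_apply]
      ring
    refine tendsto_integral_of_dominated_convergence _
      (fun n => ((hu n).continuous.pow 6).aestronglyMeasurable) h6
      (fun n => ae_of_all _ fun x => ?_) (ae_of_all _ fun x => ?_)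
    · rw [Real.norm_of_nonneg (by positivity), mul_pow]
      exact mul_le_of_le_one_left (by positivity) (pow_le_one₀ χ.nonneg χ.le_one)
    · have hr : Tendsto (fun n => r n • x) atTop (nhds (0 : Pt)) := by
        simpa [r] using (tendsto_one_div_add_atTop_nhds_zero_nat (𝕜 := ℝ)).smul_const x
      have hev : ∀ᶠ n in atTop, u n x ^ 6 = f x ^ 6 := by
        filter_upwards [hr (Metric.closedBall_mem_nhds 0 one_pos)] with n hn
        simp only [u]
        rw [χ.one_of_mem_closedBall hn, one_mul]
      exact (tendsto_congr' hev).2 tendsto_const_nhds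
  exact le_of_tendsto' hlim hbound

/-- The embedding `H¹ ⊂ L⁴`. -/
lemma exists_integral_pow_four_le : ∃ K : ℝ, 0 ≤ K ∧ ∀ f : 𝓢(Pt, ℝ),
    ∫ x, f x ^ 4 ≤ K * hSq 1 f ^ 2 := by
  obtain ⟨K, hK, hf6⟩ := exists_integral_pow_six_le
  refine ⟨√K, by positivity, fun f => ?_⟩
  have hcs := sq_integral_mul_le f (schwartzMul f (schwartzMul f f))
  have e4 : ∫ x, f x * schwartzMul f (schwartzMul f f) x = ∫ x, f x ^ 4 := by
    congr 1; ext x; simp only [schwartzMul_apply]; ring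
  have e6 : ∫ x, schwartzMul f (schwartzMul f f) x * schwartzMul f (schwartzMul f f) x
      = ∫ x, f x ^ 6 := by
    congr 1; ext x; simp only [schwartzMul_apply]; ring
  rw [e4, e6] at hcs
  have h2 : ∫ x, f x * f x ≤ hSq 1 f := by
    rw [hSq_one_coe]
    exact le_add_of_nonneg_right
      (Finset.sum_nonneg fun k _ => integral_nonneg fun _ => mul_self_nonneg _)
  have h0 : 0 ≤ hSq 1 f := hSq_nonneg 1 f
  refine le_of_sq_le_sq ?_ (by positivity)
  calc _ ≤ hSq 1 f * (K * hSq 1 f ^ 3) := hcs.trans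
        (mul_le_mul h2 (hf6 f) (integral_nonneg fun x => by positivity) h0)
    _ = _ := by rw [mul_pow, Real.sq_sqrt hK]; ring

lemma hInner_one_pd_lapl (i : Fin 3) (f g : 𝓢(Pt, ℝ)) :
    hInner 1 (pd i f) (lapl g) =
      ∫ x, (-schwartzLapl f) x * (schwartzPd i g - schwartzLapl (schwartzPd i g)) x := by
  have hk : ∀ k, ∫ x, pd k (pd i f) x * pd k (lapl g) x
      = ∫ x, schwartzLapl f x * schwartzPd k (schwartzPd k (schwartzPd i g)) x := fun k => by
    simp only [lapl_coe, pd_coe]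
    rw [schwartzPd_comm k i, schwartzPd_lapl, integral_schwartzPd_mul_schwartzLapl,
      ← schwartzPd_lapl, schwartzPd_comm i k, integral_mul_schwartzPd k (schwartzLapl f)]
  rw [hInner_one, Finset.sum_congr rfl fun k _ => hk k,
    ← integral_finsetSum _ fun k _ => integrable_mul_schwartz _ _]
  simp only [lapl_coe, pd_coe]
  rw [integral_schwartzPd_mul_schwartzLapl, ← integral_neg,
    ← integral_add (by exact (integrable_mul_schwartz _ _).neg)
      (integrable_finsetSum _ fun k _ => integrable_mul_schwartz _ _)]
  congr 1
  ext x
  rw [← Finset.mul_sum, _root_.neg_apply, _root_.sub_apply,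
    schwartzLapl.eq_1 (schwartzPd i g), _root_.sum_apply]
  ring

lemma integral_sq_sub_lapl_le (f : 𝓢(Pt, ℝ)) :
    ∫ x, (f - schwartzLapl f) x * (f - schwartzLapl f) x ≤ 4 * hSq 2 f := by
  have h2 := integral_sq_add_sum_pd_pd_le_hSq_two f
  simp only [pd_coe] at h2
  have hInteg : Integrable fun x => ∑ k, schwartzPd k (schwartzPd k f) x *
      schwartzPd k (schwartzPd k f) x :=
    integrable_finsetSum _ fun k _ => integrable_mul_schwartz _ _
  rw [← integral_finsetSum _ fun k _ => integrable_mul_schwartz _ _,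
    ← integral_add (integrable_mul_schwartz _ _) hInteg] at h2
  refine le_trans ?_ (mul_le_mul_of_nonneg_left h2 (by norm_num))
  rw [← integral_const_mul]
  refine integral_mono (integrable_mul_schwartz _ _)
    (((integrable_mul_schwartz _ _).add hInteg).const_mul 4) fun x => ?_
  rw [_root_.sub_apply, schwartzLapl, _root_.sum_apply]
  simp only [Fin.sum_univ_three]
  generalize f x = a
  generalize schwartzPd 0 (schwartzPd 0 f) x = b
  generalize schwartzPd 1 (schwartzPd 1 f) x = c
  generalize schwartzPd 2 (schwartzPd 2 f) x = d
  nlinarith [sq_nonneg (a + b), sq_nonneg (a + c), sq_nonneg (a + d),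
    sq_nonneg (b - c), sq_nonneg (b - d), sq_nonneg (c - d)]

lemma exists_integral_sq_le_gradVecHSq : ∃ K : ℝ, 0 ≤ K ∧
    ∀ (F : 𝓢(Pt, ℝ)) (v : Fin 3 → 𝓢(Pt, ℝ)),
      (∀ x, F x = ∑ i, ∑ j, schwartzPd i (v j) x * schwartzPd j (v i) x) →
      ∫ x, F x * F x ≤ K * gradVecHSq 2 (fun j => v j) ^ 2 := by
  obtain ⟨K, hK, h4⟩ := exists_integral_pow_four_le
  refine ⟨9 * K, by positivity, fun F v hF => ?_⟩
  have hInteg : ∀ i j, Integrable fun x => schwartzPd i (v j) x ^ 4 := fun i j => by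
    set g := schwartzPd i (v j)
    convert! integrable_mul_schwartz (schwartzMul g g) (schwartzMul g g) using 2 with x
    simp only [schwartzMul_apply]
    ring
  have hintS : Integrable fun x => ∑ i, ∑ j, schwartzPd i (v j) x ^ 4 :=
    integrable_finsetSum _ fun i _ => integrable_finsetSum _ fun j _ => hInteg i j
  have hpt : ∀ x, F x * F x ≤ 9 * ∑ i, ∑ j, schwartzPd i (v j) x ^ 4 := fun x => by
    set a : Fin 3 → Fin 3 → ℝ := fun i j => schwartzPd i (v j) x
    have hFa : F x = ∑ i, ∑ j, a i j * a j i := hF x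
    have h1 : (∑ i, ∑ j, a i j * a j i) ^ 2 ≤ 3 * ∑ i, (∑ j, a i j * a j i) ^ 2 := by
      simpa using sq_sum_le_card_mul_sum_sq (s := Finset.univ) (f := fun i => ∑ j, a i j * a j i)
    have h2 : ∀ i, (∑ j, a i j * a j i) ^ 2 ≤ 3 * ∑ j, (a i j * a j i) ^ 2 := fun i => by
      simpa using sq_sum_le_card_mul_sum_sq (s := Finset.univ) (f := fun j => a i j * a j i)
    have h3 : ∑ i, ∑ j, (a i j * a j i) ^ 2 ≤ ∑ i, ∑ j, (a i j ^ 4 + a j i ^ 4) / 2 :=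
      Finset.sum_le_sum fun i _ => Finset.sum_le_sum fun j _ => by
        nlinarith [sq_nonneg (a i j ^ 2 - a j i ^ 2)]
    have h5 : ∑ i, ∑ j, (a i j ^ 4 + a j i ^ 4) / 2 = ∑ i, ∑ j, a i j ^ 4 := by
      simp only [Fin.sum_univ_three]
      ring
    have h6 : ∑ i, (∑ j, a i j * a j i) ^ 2 ≤ 3 * ∑ i, ∑ j, (a i j * a j i) ^ 2 := by
      rw [Finset.mul_sum]
      exact Finset.sum_le_sum fun i _ => h2 i
    rw [← sq, hFa]
    linarith
  calc ∫ x, F x * F x ≤ ∫ x, 9 * ∑ i, ∑ j, schwartzPd i (v j) x ^ 4 :=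
        integral_mono (integrable_mul_schwartz F F) (hintS.const_mul 9) hpt
    _ = 9 * ∑ i, ∑ j, ∫ x, schwartzPd i (v j) x ^ 4 := by
        rw [integral_const_mul, integral_finsetSum _ fun i _ =>
          integrable_finsetSum _ fun j _ => hInteg i j]
        simp only [integral_finsetSum _ fun j _ => hInteg _ j]
    _ ≤ 9 * ∑ i, ∑ j, K * hSq 2 (schwartzPd i (v j)) ^ 2 := by
        gcongr with i _ j _
        exact (h4 _).trans (mul_le_mul_of_nonneg_left
          (pow_le_pow_left₀ (hSq_nonneg _ _) (hSq_one_le_two _) 2) hK)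
    _ = 9 * K * ∑ j, ∑ i, hSq 2 (schwartzPd i (v j)) ^ 2 := by
        rw [Finset.sum_comm]
        simp only [← Finset.mul_sum]
        ring
    _ ≤ 9 * K * gradVecHSq 2 (fun j => v j) ^ 2 := by
        refine mul_le_mul_of_nonneg_left ?_ (by positivity)
        have hj : ∀ j, 0 ≤ gradHSq 2 (v j) := fun j =>
          Finset.sum_nonneg fun i _ => hSq_nonneg _ _
        refine le_trans (Finset.sum_le_sum fun j _ => ?_)
          (Finset.sum_sq_le_sq_sum_of_nonneg fun j _ => hj j)
        exact Finset.sum_sq_le_sq_sum_of_nonneg fun i _ => hSq_nonneg _ _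

lemma gradHSq_nonneg (k : ℕ) (f : Pt → ℝ) : 0 ≤ gradHSq k f :=
  Finset.sum_nonneg fun _ _ => hSq_nonneg _ _

lemma gradVecHSq_nonneg (k : ℕ) (v : Fin 3 → Pt → ℝ) : 0 ≤ gradVecHSq k v :=
  Finset.sum_nonneg fun _ _ => gradHSq_nonneg _ _

/-- The estimate at a fixed time. -/
lemma exists_abs_hInner_pd_lapl_le : ∃ C : ℝ, 0 < C ∧
    ∀ (ψ w : Pt → ℝ) (v : Fin 3 → Pt → ℝ), IsSchwartz ψ → IsSchwartz w →
      (∀ j, IsSchwartz (v j)) →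
      (∀ x, -(lapl w x) = ∑ i, ∑ j, pd i (v j) x * pd j (v i) x) →
      |hInner 1 (pd 2 w) (lapl ψ)| ≤ C * gradVecHSq 2 v * √(gradHSq 2 ψ) := by
  obtain ⟨K, hK, hKv⟩ := exists_integral_sq_le_gradVecHSq
  refine ⟨√(4 * K) + 1, by positivity, fun ψ w v hψ hw hv heq => ?_⟩
  obtain ⟨P, rfl⟩ := hψ.exists_schwartzMap
  obtain ⟨W, rfl⟩ := hw.exists_schwartzMap
  choose V hV using fun j => (hv j).exists_schwartzMap
  obtain rfl : (fun j => ⇑(V j)) = v := funext hV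
  have hF : ∀ x, (-schwartzLapl W) x = ∑ i, ∑ j, schwartzPd i (V j) x * schwartzPd j (V i) x := by
    simpa only [lapl_coe, pd_coe, _root_.neg_apply] using heq
  have hG := gradVecHSq_nonneg 2 fun j => V j
  have hP := gradHSq_nonneg 2 P
  set G := gradVecHSq 2 fun j => V j
  have hψP : hSq 2 (schwartzPd 2 P) ≤ gradHSq 2 P :=
    Finset.single_le_sum (f := fun i => hSq 2 (pd i P)) (fun i _ => hSq_nonneg _ _)
      (Finset.mem_univ 2)
  have h2 : hInner 1 (pd 2 W) (lapl P) ^ 2 ≤ (√(4 * K) * G * √(gradHSq 2 P)) ^ 2 := by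
    rw [hInner_one_pd_lapl]
    refine (sq_integral_mul_le _ _).trans ?_
    calc _ ≤ K * G ^ 2 * (4 * gradHSq 2 P) :=
          mul_le_mul (hKv _ V hF)
            ((integral_sq_sub_lapl_le _).trans (mul_le_mul_of_nonneg_left hψP (by norm_num)))
            (integral_nonneg fun _ => mul_self_nonneg _) (by positivity)
      _ = _ := by
          rw [mul_pow, mul_pow, Real.sq_sqrt (by positivity), Real.sq_sqrt hP]
          ring
  refine (abs_le_of_sq_le_sq h2 (by positivity)).trans ?_
  gcongr
  linarith

end SobolevEstimates

/-- The estimate (2.24): with `w = (-Δ)⁻¹[∑_{i,j} ∂ᵢvⱼ ∂ⱼvᵢ]`,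
`|∫₀^T (∂₃w|Δψ)_{H¹} dt| ≤ C ‖∇v‖²_{L²_T(H²)} ‖∇ψ‖_{L^∞_T(H²)}`. -/
theorem stmt_17 :
    ∃ C : ℝ, 0 < C ∧ ∀ T : ℝ, 0 < T →
      ∀ (ψ w : ℝ → Pt → ℝ) (v : Fin 3 → ℝ → Pt → ℝ),
      SmoothOn2 (Icc 0 T) ψ → SmoothOn2 (Icc 0 T) w → (∀ j, SmoothOn2 (Icc 0 T) (v j)) →
      (∀ t ∈ Icc (0:ℝ) T, IsSchwartz (ψ t) ∧ IsSchwartz (w t) ∧ ∀ j, IsSchwartz (v j t)) →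
      (∀ t ∈ Icc (0:ℝ) T, ∀ x,
        -(lapl (w t) x) = ∑ i, ∑ j, pd i (v j t) x * pd j (v i t) x) →
      BddAbove ((fun t => Real.sqrt (gradHSq 2 (ψ t))) '' Icc 0 T) →
      IntervalIntegrable (fun t => gradVecHSq 2 fun j => v j t) volume 0 T →
      |∫ t in (0:ℝ)..T, hInner 1 (pd 2 (w t)) (lapl (ψ t))| ≤
        C * (l2T T fun t => Real.sqrt (gradVecHSq 2 fun j => v j t)) ^ 2
          * (supT T fun t => Real.sqrt (gradHSq 2 (ψ t))) := by
  obtain ⟨C, hC, hfix⟩ := exists_abs_hInner_pd_lapl_le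
  refine ⟨C, hC, fun T hT ψ w v _ _ _ hS heq hbdd hInteg => ?_⟩
  have hl2 : (l2T T fun t => √(gradVecHSq 2 fun j => v j t)) ^ 2
      = ∫ t in (0:ℝ)..T, gradVecHSq 2 fun j => v j t := by
    simp only [l2T, Real.sq_sqrt (gradVecHSq_nonneg _ _)]
    exact Real.sq_sqrt
      (intervalIntegral.integral_nonneg hT.le fun t _ => gradVecHSq_nonneg _ _)
  rw [hl2, ← intervalIntegral.integral_const_mul, ← intervalIntegral.integral_mul_const,
    ← Real.norm_eq_abs]
  refine intervalIntegral.norm_integral_le_of_norm_le hT.le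
    (ae_of_all _ fun t ht => ?_) ((hInteg.const_mul C).mul_const _)
  have ht' : t ∈ Icc (0:ℝ) T := Ioc_subset_Icc_self ht
  obtain ⟨hψ, hw, hv⟩ := hS t ht'
  exact (hfix _ _ _ hψ hw hv (heq t ht')).trans <| mul_le_mul_of_nonneg_left
    (le_csSup hbdd (mem_image_of_mem _ ht')) (mul_nonneg hC.le (gradVecHSq_nonneg _ _))

end
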